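/- Let (pE, pT) be a single-component TractOR model over entities D and relation symbols R. Let A, B ∈ D with A ≠ B and let R₀, S₀, T₀ ∈ R be pairwise distinct relation symbols. Consider the query H₀ = ∃x,y. R₀(A,x) ∧ S₀(x,y) ∧ T₀(y,B), interpreted under the TractOR decomposition as the event {ω | ∃ x, y ∈ D, ω(E A) ∧ ω(T R₀) ∧ ω(E x) ∧ ω(T S₀) ∧ ω(E y) ∧ ω(T T₀) ∧ ω(E B)}. Then this event equals {ω | ω(E A) ∧ ω(T R₀) ∧ ω(T S₀) ∧ ω(T T₀) ∧ ω(E B)}, and its probability is P(H₀) = pE(A) · pT(R₀) · pT(S₀) · pT(T₀) · pE(B). In particular the query H₀, which is #P-hard over arbitrary tuple-independent probabilistic databases, has a closed-form probability under the TractOR model. -/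

import Mathlib

open Classical in
/-- The probability of a set `W` of worlds in the tuple-independent probabilistic
database `p : T → [0,1]`. -/
noncomputable def Pr {T : Type*} [Fintype T] [DecidableEq T]
    (p : T → ℝ) (W : Set (T → Bool)) : ℝ :=
  ∑ ω : T → Bool, if ω ∈ W then ∏ t : T, (if ω t then p t else 1 - p t) else 0

/-- The tuples of a finite set `S` are simultaneously true with probability `∏ t ∈ S, p t`. -/
theorem Pr_forall_mem_eq_true {T : Type*} [Fintype T] [DecidableEq T] (p : T → ℝ)
    (S : Finset T) : Pr p {ω | ∀ t ∈ S, ω t = true} = ∏ t ∈ S, p t := by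
  have hfactor (ω : T → Bool) :
      (if ∀ t ∈ S, ω t = true then ∏ t, (if ω t then p t else 1 - p t) else 0) =
        ∏ t, (if t ∈ S ∧ ω t = false then 0 else if ω t then p t else 1 - p t) := by
    by_cases h : ∀ t ∈ S, ω t = true
    · rw [if_pos h]
      refine Finset.prod_congr rfl fun t _ => ?_
      exact (if_neg fun ⟨ht, hf⟩ => by simp [h t ht] at hf).symm
    · rw [if_neg h]
      push Not at h
      obtain ⟨t, ht, hf⟩ := h
      refine (Finset.prod_eq_zero (Finset.mem_univ t) ?_).symm
      simp [ht, Bool.eq_false_iff.mpr hf]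
  calc Pr p {ω | ∀ t ∈ S, ω t = true}
      = ∑ ω : T → Bool,
          ∏ t, (if t ∈ S ∧ ω t = false then 0 else if ω t then p t else 1 - p t) := by
        refine Finset.sum_congr rfl fun ω _ => ?_
        rw [← hfactor ω]
        simp only [Set.mem_ofPred_eq]
        congr
    _ = ∏ t, ∑ b : Bool, (if t ∈ S ∧ b = false then 0 else if b then p t else 1 - p t) :=
        (Fintype.prod_sum fun t b =>
          if t ∈ S ∧ b = false then 0 else if b then p t else 1 - p t).symm
    _ = ∏ t, (if t ∈ S then p t else 1) := by
        refine Finset.prod_congr rfl fun t _ => ?_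
        by_cases ht : t ∈ S <;> simp [ht]
    _ = ∏ t ∈ S, p t := by simp

/-- Under a single-component TractOR model (entity tuples `E(c) = Sum.inl c` with
parameters `pE`, relation tuples `T(r) = Sum.inr r` with parameters `pT`), the query
`H₀ = ∃x,y. R₀(A,x) ∧ S₀(x,y) ∧ T₀(y,B)` — interpreted via the TractOR decomposition
`R(x,y) ⇔ E(x) ∧ T(R) ∧ E(y)` — defines the event
`{ω | ω(E A) ∧ ω(T R₀) ∧ ω(T S₀) ∧ ω(T T₀) ∧ ω(E B)}`, and its probability is
`pE A · pT R₀ · pT S₀ · pT T₀ · pE B`.  Thus the query `H₀`, which is #P-hard over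
arbitrary tuple-independent PDBs, has a closed-form probability under TractOR. -/
theorem tractor_H0_closed_form
    {D R : Type*} [Fintype D] [Fintype R] [DecidableEq D] [DecidableEq R]
    (pE : D → ℝ) (pT : R → ℝ)
    (hE : ∀ c : D, 0 ≤ pE c ∧ pE c ≤ 1) (hT : ∀ r : R, 0 ≤ pT r ∧ pT r ≤ 1)
    (A B : D) (hAB : A ≠ B)
    (R₀ S₀ T₀ : R) (hRS : R₀ ≠ S₀) (hRT : R₀ ≠ T₀) (hST : S₀ ≠ T₀) :
    ({ω : D ⊕ R → Bool | ∃ x y : D,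
        ω (Sum.inl A) = true ∧ ω (Sum.inr R₀) = true ∧ ω (Sum.inl x) = true ∧
        ω (Sum.inr S₀) = true ∧ ω (Sum.inl y) = true ∧ ω (Sum.inr T₀) = true ∧
        ω (Sum.inl B) = true} =
      {ω : D ⊕ R → Bool |
        ω (Sum.inl A) = true ∧ ω (Sum.inr R₀) = true ∧ ω (Sum.inr S₀) = true ∧
        ω (Sum.inr T₀) = true ∧ ω (Sum.inl B) = true}) ∧
    Pr (Sum.elim pE pT)
        {ω : D ⊕ R → Bool | ∃ x y : D,
          ω (Sum.inl A) = true ∧ ω (Sum.inr R₀) = true ∧ ω (Sum.inl x) = true ∧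
          ω (Sum.inr S₀) = true ∧ ω (Sum.inl y) = true ∧ ω (Sum.inr T₀) = true ∧
          ω (Sum.inl B) = true} =
      pE A * pT R₀ * pT S₀ * pT T₀ * pE B := by
  have hevent : {ω : D ⊕ R → Bool | ∃ x y : D,
        ω (Sum.inl A) = true ∧ ω (Sum.inr R₀) = true ∧ ω (Sum.inl x) = true ∧
        ω (Sum.inr S₀) = true ∧ ω (Sum.inl y) = true ∧ ω (Sum.inr T₀) = true ∧
        ω (Sum.inl B) = true} =
      {ω : D ⊕ R → Bool |
        ω (Sum.inl A) = true ∧ ω (Sum.inr R₀) = true ∧ ω (Sum.inr S₀) = true ∧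
        ω (Sum.inr T₀) = true ∧ ω (Sum.inl B) = true} := by
    ext ω
    constructor
    · rintro ⟨x, y, hA, hR, -, hS, -, hT', hB⟩
      exact ⟨hA, hR, hS, hT', hB⟩
    · rintro ⟨hA, hR, hS, hT', hB⟩
      exact ⟨A, B, hA, hR, hA, hS, hB, hT', hB⟩
  refine ⟨hevent, ?_⟩
  rw [hevent]
  have h := Pr_forall_mem_eq_true (Sum.elim pE pT)
    {Sum.inl A, Sum.inr R₀, Sum.inr S₀, Sum.inr T₀, Sum.inl B}
  simpa [Finset.prod_insert, hAB, hRS, hRT, hST, mul_assoc] using h
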